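/- arXiv:1907.03823 — 6 statements merged into one kernel-verified Lean document; each statement's English description precedes it below -/
import Mathlib

section
/- Let p₁, n₁, p₂, n₂ be natural numbers with p₂ ≤ p₁ ≤ n₁ ≤ n₂ and p₁ + n₁ = p₂ + n₂ = d, let p̄₁, n̄₁, p̄₂, n̄₂ ≥ 0, and let H₁ = diag(p̄₁·I_{p₁}, −n̄₁·I_{n₁}) and H₂ = diag(p̄₂·I_{p₂}, −n̄₂·I_{n₂}) be d×d diagonal matrices. Let G be a real orthogonal d×d matrix (G·Gᵀ = I) partitioned so that G₁ is its top-left p₂×p₁ block. Set k₁ = ½(p̄₁+n̄₁)(p̄₂+n̄₂), k₂ = ½(p̄₁n̄₂+n̄₁p̄₂), r̄² = p̄₁n̄₁p̄₂n̄₂, and let c₁², …, c_{p₂}² be the eigenvalues (with multiplicity) of the real symmetric p₂×p₂ matrix G₁G₁ᵀ. Then the characteristic polynomial of G H₁ Gᵀ H₂ equals (∏_{i=1}^{p₂} (X² − 2(k₁cᵢ² − k₂)X + r̄²)) · (X + p̄₁n̄₂)^{p₁−p₂} · (X − n̄₁n̄₂)^{n₂−p₁}. -/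
open Matrix Polynomial

/-- The determinant of an affine function of a Hermitian real matrix, in terms of eigenvalues. -/
theorem Matrix.IsHermitian.det_smul_one_sub_smul {n : Type*} [Fintype n] [DecidableEq n]
    {A : Matrix n n ℝ} (hA : A.IsHermitian) (s t : ℝ) :
    (s • (1 : Matrix n n ℝ) - t • A).det = ∏ i, (s - t * hA.eigenvalues i) := by
  rcases eq_or_ne t 0 with rfl | ht
  · simp
  · have h : s • (1 : Matrix n n ℝ) - t • A = t • (Matrix.scalar n (s / t) - A) := by
      rw [smul_sub, show Matrix.scalar n (s / t) = (s / t) • (1 : Matrix n n ℝ) by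
          simp [Matrix.smul_one_eq_diagonal], smul_smul, mul_div_cancel₀ _ ht]
    rw [h, Matrix.det_smul, ← Matrix.eval_charpoly, hA.charpoly_eq, eval_prod,
      Fintype.card, ← Finset.prod_const, ← Finset.prod_mul_distrib]
    refine Finset.prod_congr rfl fun i _ => ?_
    simp only [eval_sub, eval_X, eval_C, RCLike.ofReal_real_eq_id, id]
    field_simp

/-- The matrix whose columns are the first `m` standard basis vectors of `ℝᵈ`. -/
def firstColumns {d m : ℕ} (h : m ≤ d) : Matrix (Fin d) (Fin m) ℝ :=
  (1 : Matrix (Fin d) (Fin d) ℝ).submatrix id (Fin.castLE h)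

theorem firstColumns_transpose_mul_self {d m : ℕ} (h : m ≤ d) :
    (firstColumns h)ᵀ * firstColumns h = 1 := by
  ext i j
  simp [firstColumns, Matrix.mul_apply, Matrix.one_apply, eq_comm]

theorem firstColumns_mul_transpose_self {d m : ℕ} (h : m ≤ d) :
    firstColumns h * (firstColumns h)ᵀ =
      Matrix.diagonal fun j : Fin d => if (j : ℕ) < m then (1 : ℝ) else 0 := by
  ext i j
  simp only [firstColumns, Matrix.mul_apply, Matrix.one_apply, Matrix.diagonal_apply,
    Matrix.transpose_apply, Matrix.submatrix_apply, id]
  by_cases hi : (i : ℕ) < m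
  · rw [Finset.sum_eq_single ⟨i, hi⟩]
    · simp [Fin.ext_iff, hi, eq_comm]
    · intro b _ hb
      rw [if_neg, zero_mul]
      rintro rfl
      exact hb rfl
    · simp
  · rw [Finset.sum_eq_zero]
    · simp [hi]
    · intro b _
      rw [if_neg, zero_mul]
      rintro rfl
      exact hi b.2

theorem transpose_firstColumns_mul_mul_firstColumns {d m k : ℕ} (hm : m ≤ d) (hk : k ≤ d)
    (G : Matrix (Fin d) (Fin d) ℝ) :
    (firstColumns hm)ᵀ * G * firstColumns hk =
      G.submatrix (Fin.castLE hm) (Fin.castLE hk) := by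
  ext i j
  simp [firstColumns, Matrix.mul_apply, Matrix.one_apply]

theorem diagonal_ite_lt_eq {d m : ℕ} (h : m ≤ d) (a b : ℝ) :
    (Matrix.diagonal fun j : Fin d => if (j : ℕ) < m then a else b) =
      b • (1 : Matrix (Fin d) (Fin d) ℝ) - (b - a) • (firstColumns h * (firstColumns h)ᵀ) := by
  rw [firstColumns_mul_transpose_self]
  ext i j
  by_cases hij : i = j
  · subst hij
    by_cases hi : (i : ℕ) < m <;> simp [hi]
  · simp [hij]

theorem prod_ite_lt {d m k : ℕ} (h : m + k = d) (a b : ℝ) :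
    (∏ j : Fin d, if (j : ℕ) < m then a else b) = a ^ m * b ^ k := by
  subst h
  simp [Fin.prod_univ_add]

/-- CS-decomposition based closed form for the characteristic polynomial of
`G H₁ Gᵀ H₂`, where `H₁ = diag(p̄₁ I_{p₁}, −n̄₁ I_{n₁})`, `H₂ = diag(p̄₂ I_{p₂}, −n̄₂ I_{n₂})`,
`p₂ ≤ p₁ ≤ n₁ ≤ n₂`, `p₁ + n₁ = p₂ + n₂ = d`, `G` orthogonal, and `c₁², …, c_{p₂}²` are the
eigenvalues of the symmetric matrix `G₁ G₁ᵀ` built from the top-left `p₂ × p₁` block `G₁` of `G`.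
Here `pbar = p̄`, `nbar = n̄`, `k₁ = (p̄₁+n̄₁)(p̄₂+n̄₂)/2`, `k₂ = (p̄₁n̄₂+n̄₁p̄₂)/2`,
`r̄² = p̄₁n̄₁p̄₂n̄₂`. -/
theorem stmt3 (d p₁ n₁ p₂ n₂ : ℕ)
    (h21 : p₂ ≤ p₁) (h11 : p₁ ≤ n₁) (h12 : n₁ ≤ n₂)
    (hd1 : p₁ + n₁ = d) (hd2 : p₂ + n₂ = d)
    (pbar₁ nbar₁ pbar₂ nbar₂ : ℝ)
    (hp₁ : 0 ≤ pbar₁) (hn₁ : 0 ≤ nbar₁) (hp₂ : 0 ≤ pbar₂) (hn₂ : 0 ≤ nbar₂)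
    (G : Matrix (Fin d) (Fin d) ℝ) (hG : G * Gᵀ = 1)
    (H₁ H₂ : Matrix (Fin d) (Fin d) ℝ)
    (hH₁ : H₁ = Matrix.diagonal fun j : Fin d => if (j : ℕ) < p₁ then pbar₁ else -nbar₁)
    (hH₂ : H₂ = Matrix.diagonal fun j : Fin d => if (j : ℕ) < p₂ then pbar₂ else -nbar₂)
    (G₁ : Matrix (Fin p₂) (Fin p₁) ℝ)
    (hG₁ : ∀ (i : Fin p₂) (j : Fin p₁),
      G₁ i j = G ⟨i.1, by have := i.2; omega⟩ ⟨j.1, by have := j.2; omega⟩)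
    (hsym : (G₁ * G₁ᵀ).IsHermitian) :
    (G * H₁ * Gᵀ * H₂).charpoly =
      (∏ i : Fin p₂,
        (X ^ 2
          - C (2 * ((pbar₁ + nbar₁) * (pbar₂ + nbar₂) / 2 * hsym.eigenvalues i
                - (pbar₁ * nbar₂ + nbar₁ * pbar₂) / 2)) * X
          + C (pbar₁ * nbar₁ * pbar₂ * nbar₂))) *
      (X + C (pbar₁ * nbar₂)) ^ (p₁ - p₂) * (X - C (nbar₁ * nbar₂)) ^ (n₂ - p₁) := by
  have hm₁ : p₁ ≤ d := by omega
  have hm₂ : p₂ ≤ d := by omega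
  have hG' : Gᵀ * G = 1 := mul_eq_one_comm.mp hG
  have hdet : G.det * Gᵀ.det = 1 := by rw [← Matrix.det_mul, hG, Matrix.det_one]
  have hG₁' : G₁ = (firstColumns hm₂)ᵀ * G * firstColumns hm₁ := by
    rw [transpose_firstColumns_mul_mul_firstColumns]
    ext i j
    exact hG₁ i j
  refine Polynomial.eq_of_infinite_eval_eq _ _ (Set.Infinite.mono (s := {nbar₁ * nbar₂,
    -(pbar₁ * nbar₂)}ᶜ) ?_ (Set.Finite.infinite_compl (Set.toFinite _)))
  intro x hx
  simp only [Set.mem_compl_iff, Set.mem_insert_iff, Set.mem_singleton_iff, not_or] at hx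
  have hy : x - nbar₁ * nbar₂ ≠ 0 := sub_ne_zero.mpr hx.1
  have hz : x + pbar₁ * nbar₂ ≠ 0 := fun h => hx.2 (by linarith)
  set y := x - nbar₁ * nbar₂ with hy_def
  set z := x + pbar₁ * nbar₂ with hz_def
  set v := pbar₂ + nbar₂ with hv_def
  set J := firstColumns hm₂ with hJ_def
  set D : Matrix (Fin d) (Fin d) ℝ :=
    Matrix.diagonal fun j : Fin d => if (j : ℕ) < p₁ then z else y with hD_def
  set B : Matrix (Fin d) (Fin d) ℝ :=
    Matrix.diagonal fun j : Fin d => if (j : ℕ) < p₁ then -(v * pbar₁ / z) else v * nbar₁ / y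
    with hB_def
  have hD : D = x • 1 + nbar₂ • H₁ := by
    rw [hD_def, hH₁]
    ext i j
    by_cases hij : i = j
    · subst hij
      by_cases hi : (i : ℕ) < p₁ <;> simp [hi, hy_def, hz_def] <;> ring
    · simp [hij]
  have hDB : D * B = -(v • H₁) := by
    rw [hD_def, hB_def, hH₁, Matrix.diagonal_mul_diagonal]
    ext i j
    by_cases hij : i = j
    · subst hij
      by_cases hi : (i : ℕ) < p₁
      · simp [hi]
        field_simp
      · simp [hi]
        field_simp
    · simp [hij]
  have hH₂' : H₂ = v • (J * Jᵀ) - nbar₂ • 1 := by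
    rw [hH₂, diagonal_ite_lt_eq hm₂, ← hJ_def, hv_def]
    module
  have hfac : Matrix.scalar (Fin d) x - G * H₁ * Gᵀ * H₂ =
      G * D * Gᵀ * (1 + G * B * Gᵀ * J * Jᵀ) := by
    have h₁ : G * D * Gᵀ = x • 1 + nbar₂ • (G * H₁ * Gᵀ) := by
      rw [hD]
      simp [mul_add, add_mul, hG]
    have h₂ : G * D * Gᵀ * (G * B * Gᵀ * J * Jᵀ) = -(v • (G * H₁ * Gᵀ * (J * Jᵀ))) := by
      calc _ = G * D * (Gᵀ * G) * B * Gᵀ * J * Jᵀ := by simp only [Matrix.mul_assoc]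
        _ = G * (D * B) * Gᵀ * (J * Jᵀ) := by
          rw [hG', Matrix.mul_one]
          simp only [Matrix.mul_assoc]
        _ = _ := by simp [hDB]
    rw [mul_add, h₂, Matrix.mul_one, h₁, hH₂', mul_sub, Matrix.mul_smul, Matrix.mul_smul,
      Matrix.mul_one, show Matrix.scalar (Fin d) x = x • (1 : Matrix (Fin d) (Fin d) ℝ) by
        simp [Matrix.smul_one_eq_diagonal]]
    module
  have hdetD : (G * D * Gᵀ).det = z ^ p₁ * y ^ n₁ := by
    rw [Matrix.det_mul, Matrix.det_mul, mul_right_comm, hdet, one_mul, hD_def,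
      Matrix.det_diagonal, prod_ite_lt hd1]
  have hcomp : 1 + Jᵀ * (G * B * Gᵀ * J) =
      (1 + v * nbar₁ / y) • (1 : Matrix (Fin p₂) (Fin p₂) ℝ) -
        (v * nbar₁ / y + v * pbar₁ / z) • (G₁ * G₁ᵀ) := by
    have hJ : Jᵀ * J = 1 := firstColumns_transpose_mul_self hm₂
    have h₁ : Jᵀ * (G * (1 : Matrix (Fin d) (Fin d) ℝ) * Gᵀ * J) = 1 := by
      rw [Matrix.mul_one, hG, Matrix.one_mul, hJ]
    have h₂ : Jᵀ * (G * (firstColumns hm₁ * (firstColumns hm₁)ᵀ) * Gᵀ * J) = G₁ * G₁ᵀ := by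
      rw [hG₁']
      simp only [Matrix.transpose_mul, Matrix.transpose_transpose, Matrix.mul_assoc]
    rw [hB_def, diagonal_ite_lt_eq hm₁]
    simp only [Matrix.mul_sub, Matrix.sub_mul, Matrix.mul_smul, Matrix.smul_mul]
    rw [h₁, h₂]
    module
  rw [Set.mem_ofPred_eq, Matrix.eval_charpoly, hfac, Matrix.det_mul, hdetD,
    Matrix.det_one_add_mul_comm, hcomp, hsym.det_smul_one_sub_smul]
  simp only [eval_mul, eval_prod, eval_pow, eval_add, eval_sub, eval_X, eval_C]
  have hprod : (z * y) ^ p₂ * ∏ i, (1 + v * nbar₁ / y -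
      (v * nbar₁ / y + v * pbar₁ / z) * hsym.eigenvalues i) =
      ∏ i, (x ^ 2 - 2 * ((pbar₁ + nbar₁) * v / 2 * hsym.eigenvalues i -
        (pbar₁ * nbar₂ + nbar₁ * pbar₂) / 2) * x + pbar₁ * nbar₁ * pbar₂ * nbar₂) := by
    have hc : (z * y) ^ p₂ = ∏ _i : Fin p₂, z * y := by simp
    rw [hc, ← Finset.prod_mul_distrib]
    refine Finset.prod_congr rfl fun i _ => ?_
    field_simp
    rw [hy_def, hz_def, hv_def]
    ring
  rw [← hprod, ← hy_def, ← hz_def, show n₂ - p₁ = n₁ - p₂ by omega,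
    ← pow_sub_mul_pow z h21, ← pow_sub_mul_pow y (h21.trans h11), mul_pow]
  ring
end

section
/- Let n̄ ≥ 0 and 0 < p̄ < 1. Then for every q ∈ ℝ, max(|(1−q) − q·n̄|, |(1−q) + q·p̄|) ≥ (p̄ + n̄)/(2 + n̄ − p̄), and equality holds for q = 2/(2 + n̄ − p̄). In particular, the minimum over q ∈ ℝ of max(|(1−q) − q·n̄|, |(1−q) + q·p̄|) equals (p̄ + n̄)/(2 + n̄ − p̄), which is strictly less than 1. -/
/-- for `n̄ ≥ 0` and `0 < p̄ < 1`, the quantity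
`max(|(1−q) − q n̄|, |(1−q) + q p̄|)` is minimised over `q ∈ ℝ` at `q = 2/(2 + n̄ − p̄)`,
with minimum value `(p̄ + n̄)/(2 + n̄ − p̄) < 1`.  Here `nbar = n̄`, `pbar = p̄`. -/
theorem stmt7 (nbar pbar : ℝ) (hn : 0 ≤ nbar) (hp0 : 0 < pbar) (hp1 : pbar < 1) :
    (∀ q : ℝ, (pbar + nbar) / (2 + nbar - pbar) ≤
        max |(1 - q) - q * nbar| |(1 - q) + q * pbar|) ∧
    (max |(1 - 2 / (2 + nbar - pbar)) - (2 / (2 + nbar - pbar)) * nbar|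
         |(1 - 2 / (2 + nbar - pbar)) + (2 / (2 + nbar - pbar)) * pbar|
      = (pbar + nbar) / (2 + nbar - pbar)) ∧
    IsLeast {v : ℝ | ∃ q : ℝ, v = max |(1 - q) - q * nbar| |(1 - q) + q * pbar|}
      ((pbar + nbar) / (2 + nbar - pbar)) ∧
    (pbar + nbar) / (2 + nbar - pbar) < 1 := by
  have hD : 0 < 2 + nbar - pbar := by linarith
  have hlower : ∀ q : ℝ, (pbar + nbar) / (2 + nbar - pbar) ≤
      max |(1 - q) - q * nbar| |(1 - q) + q * pbar| := by
    intro q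
    rw [div_le_iff₀ hD]
    have hA := (neg_le_abs ((1 - q) - q * nbar)).trans (le_max_left _ |(1 - q) + q * pbar|)
    have hB := (le_abs_self ((1 - q) + q * pbar)).trans (le_max_right |(1 - q) - q * nbar| _)
    have hA' := mul_le_mul_of_nonneg_left hA (sub_nonneg.2 hp1.le)
    have hB' := mul_le_mul_of_nonneg_left hB (by linarith : 0 ≤ 1 + nbar)
    linarith
  have hmin : max |(1 - 2 / (2 + nbar - pbar)) - (2 / (2 + nbar - pbar)) * nbar|
      |(1 - 2 / (2 + nbar - pbar)) + (2 / (2 + nbar - pbar)) * pbar|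
      = (pbar + nbar) / (2 + nbar - pbar) := by
    have hA : (1 - 2 / (2 + nbar - pbar)) - (2 / (2 + nbar - pbar)) * nbar
        = -((pbar + nbar) / (2 + nbar - pbar)) := by
      field_simp
      ring
    have hB : (1 - 2 / (2 + nbar - pbar)) + (2 / (2 + nbar - pbar)) * pbar
        = (pbar + nbar) / (2 + nbar - pbar) := by
      field_simp
      ring
    rw [hA, hB, abs_neg, max_self, abs_of_nonneg (by positivity)]
  refine ⟨hlower, hmin, ⟨⟨_, hmin.symm⟩, ?_⟩, ?_⟩
  · rintro _ ⟨q, rfl⟩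
    exact hlower q
  · rw [div_lt_one hD]
    linarith
end

section
/- Let m be a natural number, let a, λ : Fin m → ℝ, and let n̄, p̄ ≥ 0. Assume aᵢ ≥ 0 for all i, ∑ᵢ aᵢ = 1, ∑ᵢ aᵢ λᵢ = 0, and −n̄ ≤ λᵢ ≤ p̄ for all i. Then ∑ᵢ aᵢ λᵢ² ≤ p̄ · n̄. -/
/-- if `aᵢ ≥ 0`, `∑ aᵢ = 1`, `∑ aᵢ λᵢ = 0` and `−n̄ ≤ λᵢ ≤ p̄` for all `i`,
then `∑ aᵢ λᵢ² ≤ p̄ n̄`.  Here `nbar = n̄`, `pbar = p̄`. -/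
theorem stmt10 (m : ℕ) (a lam : Fin m → ℝ) (nbar pbar : ℝ)
    (hn : 0 ≤ nbar) (hp : 0 ≤ pbar)
    (ha : ∀ i, 0 ≤ a i) (hsum : ∑ i, a i = 1) (hzero : ∑ i, a i * lam i = 0)
    (hlam : ∀ i, -nbar ≤ lam i ∧ lam i ≤ pbar) :
    ∑ i, a i * lam i ^ 2 ≤ pbar * nbar := by
  calc ∑ i, a i * lam i ^ 2
      ≤ ∑ i, ((pbar - nbar) * (a i * lam i) + pbar * nbar * a i) := by
        refine Finset.sum_le_sum fun i _ => ?_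
        have h : 0 ≤ a i * ((lam i + nbar) * (pbar - lam i)) :=
          mul_nonneg (ha i) (mul_nonneg (by linarith [(hlam i).1]) (by linarith [(hlam i).2]))
        linarith
    _ = pbar * nbar := by
        rw [Finset.sum_add_distrib, ← Finset.mul_sum, ← Finset.mul_sum, hzero, hsum]
        ring
end

section
/- Let m be a natural number, let a, μ : Fin m → ℝ, and let α, β > 0. Assume aᵢ ≥ 0 for all i, ∑ᵢ aᵢ = 1, ∑ᵢ aᵢ μᵢ = 0, and for each i either μᵢ ≥ α or μᵢ ≤ −β. Then ∑ᵢ aᵢ μᵢ² ≥ α · β. -/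
/-- if `aᵢ ≥ 0`, `∑ aᵢ = 1`, `∑ aᵢ μᵢ = 0` and each `μᵢ` satisfies
`μᵢ ≥ α` or `μᵢ ≤ −β` with `α, β > 0`, then `∑ aᵢ μᵢ² ≥ α β`. -/
theorem stmt11 (m : ℕ) (a μ : Fin m → ℝ) (α β : ℝ)
    (hα : 0 < α) (hβ : 0 < β)
    (ha : ∀ i, 0 ≤ a i) (hsum : ∑ i, a i = 1) (hzero : ∑ i, a i * μ i = 0)
    (hμ : ∀ i, α ≤ μ i ∨ μ i ≤ -β) :
    α * β ≤ ∑ i, a i * μ i ^ 2 := by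
  have hquad : ∀ i, α * β + (α - β) * μ i ≤ μ i ^ 2 := fun i => by
    rcases hμ i with h | h
    · nlinarith [mul_nonneg (sub_nonneg.2 h) (by linarith : 0 ≤ μ i + β)]
    · nlinarith [mul_nonneg (sub_nonneg.2 h) (by linarith : 0 ≤ α - μ i)]
  calc α * β = α * β * ∑ i, a i + (α - β) * ∑ i, a i * μ i := by
        rw [hsum, hzero]; ring
    _ = ∑ i, a i * (α * β + (α - β) * μ i) := by
        rw [Finset.mul_sum, Finset.mul_sum, ← Finset.sum_add_distrib]
        exact Finset.sum_congr rfl fun i _ => by ring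
    _ ≤ ∑ i, a i * μ i ^ 2 :=
        Finset.sum_le_sum fun i _ => mul_le_mul_of_nonneg_left (hquad i) (ha i)
end

section
/- Let F be a real m×n matrix with Fᵀ·F = I_n (so n ≤ m), and let S be any real n×n matrix. Then the characteristic polynomial of the m×m matrix F·S·Fᵀ − (I_m − F·Fᵀ) equals the characteristic polynomial of S multiplied by (X + 1)^(m−n). In particular, the eigenvalues of F·S·Fᵀ − (I_m − F·Fᵀ) are the eigenvalues of S together with −1 with multiplicity m − n. -/
open Matrix Polynomial

/-- if `Fᵀ F = I_n`, then the characteristic polynomial of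
`F S Fᵀ − (I_m − F Fᵀ)` is `charpoly(S) · (X + 1)^(m − n)`; in particular its eigenvalues
are those of `S` together with `−1` with multiplicity `m − n`. -/
theorem stmt15 (m n : ℕ) (F : Matrix (Fin m) (Fin n) ℝ) (S : Matrix (Fin n) (Fin n) ℝ)
    (hF : Fᵀ * F = 1) :
    (F * S * Fᵀ - (1 - F * Fᵀ)).charpoly = S.charpoly * (X + 1) ^ (m - n) := by
  have hnm : n ≤ m := by
    have hrank := (rank_mul_le_right Fᵀ F).trans F.rank_le_height
    rwa [hF, rank_one, Fintype.card_fin] at hrank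
  have hdecomp : F * S * Fᵀ - (1 - F * Fᵀ) = F * ((S + 1) * Fᵀ) - scalar (Fin m) (1 : ℝ) := by
    rw [map_one, Matrix.add_mul, Matrix.one_mul, Matrix.mul_add, Matrix.mul_assoc]
    abel
  have hshift : S = S + 1 - scalar (Fin n) (1 : ℝ) := by
    rw [map_one, add_sub_cancel_right]
  rw [hdecomp, charpoly_sub_scalar, charpoly_mul_comm_of_le _ _ (by simpa using hnm),
    Matrix.mul_assoc, hF, Matrix.mul_one, Fintype.card_fin, Fintype.card_fin, mul_comp,
    ← charpoly_sub_scalar, ← hshift, pow_comp, X_comp, map_one, mul_comm]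
end

section
/- Let C be a real symmetric positive semidefinite n×n matrix and let F be a real m×n matrix such that C + Fᵀ·F is invertible. Then F·(C + Fᵀ·F)⁻¹·Fᵀ ⪯ I_m, i.e., the matrix I_m − F·(C + Fᵀ·F)⁻¹·Fᵀ is positive semidefinite. Equivalently, the matrix U = 2·F·(C + Fᵀ·F)⁻¹·Fᵀ − I_m satisfies −I_m ⪯ U ⪯ I_m. -/
open Matrix

/-- With `M = C + Fᵀ F` and `K = F M⁻¹ Fᵀ`, the complement `1 - K` is the sum of `(1 - K)²` and
`F M⁻¹ C M⁻¹ Fᵀ`. -/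
theorem one_sub_mul_inv_mul_transpose_eq {m n : Type*} [Fintype m] [Fintype n] [DecidableEq m]
    [DecidableEq n] {R : Type*} [CommRing R] (C : Matrix n n R) (F : Matrix m n R)
    (hinv : IsUnit (C + Fᵀ * F).det) :
    1 - F * (C + Fᵀ * F)⁻¹ * Fᵀ =
      (1 - F * (C + Fᵀ * F)⁻¹ * Fᵀ) * (1 - F * (C + Fᵀ * F)⁻¹ * Fᵀ) +
        F * (C + Fᵀ * F)⁻¹ * C * ((C + Fᵀ * F)⁻¹ * Fᵀ) := by
  have h : F * (C + Fᵀ * F)⁻¹ * (C + Fᵀ * F) * ((C + Fᵀ * F)⁻¹ * Fᵀ) =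
      F * (C + Fᵀ * F)⁻¹ * Fᵀ := by
    rw [nonsing_inv_mul_cancel_right _ _ hinv, Matrix.mul_assoc]
  generalize (C + Fᵀ * F)⁻¹ = N at h ⊢
  simp only [Matrix.mul_add, Matrix.add_mul, Matrix.mul_assoc] at h
  simp only [Matrix.mul_sub, Matrix.sub_mul, Matrix.mul_one, Matrix.one_mul, Matrix.mul_assoc]
  nth_rewrite 3 [← h]
  abel

/-- if `C` is real symmetric positive semidefinite and `C + Fᵀ F` is
invertible, then `F (C + Fᵀ F)⁻¹ Fᵀ ⪯ I`, i.e. `I − F (C + Fᵀ F)⁻¹ Fᵀ` is positive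
semidefinite; equivalently `U = 2 F (C + Fᵀ F)⁻¹ Fᵀ − I` satisfies `−I ⪯ U ⪯ I`. -/
theorem stmt16 (m n : ℕ) (C : Matrix (Fin n) (Fin n) ℝ) (F : Matrix (Fin m) (Fin n) ℝ)
    (hC : C.PosSemidef) (hinv : IsUnit (C + Fᵀ * F).det) :
    (1 - F * (C + Fᵀ * F)⁻¹ * Fᵀ).PosSemidef ∧
    (1 - ((2 : ℝ) • (F * (C + Fᵀ * F)⁻¹ * Fᵀ) - 1)).PosSemidef ∧
    (((2 : ℝ) • (F * (C + Fᵀ * F)⁻¹ * Fᵀ) - 1) + 1).PosSemidef := by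
  have hM : (C + Fᵀ * F).PosSemidef := by
    simpa using hC.add (posSemidef_conjTranspose_mul_self F)
  have hN : (C + Fᵀ * F)⁻¹.PosSemidef := hM.inv
  have hK : (F * (C + Fᵀ * F)⁻¹ * Fᵀ).PosSemidef := by
    simpa using hN.mul_mul_conjTranspose_same F
  have hNt : ((C + Fᵀ * F)⁻¹)ᵀ = (C + Fᵀ * F)⁻¹ := by
    simpa only [conjTranspose_eq_transpose_of_trivial] using hN.isHermitian.eq
  have h1K : (1 - F * (C + Fᵀ * F)⁻¹ * Fᵀ).PosSemidef := by
    rw [one_sub_mul_inv_mul_transpose_eq C F hinv]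
    refine PosSemidef.add ?_ ?_
    · have h := posSemidef_conjTranspose_mul_self (1 - F * (C + Fᵀ * F)⁻¹ * Fᵀ)
      rwa [(isHermitian_one.sub hK.isHermitian).eq] at h
    · have h := hC.mul_mul_conjTranspose_same (F * (C + Fᵀ * F)⁻¹)
      rwa [conjTranspose_eq_transpose_of_trivial, transpose_mul, hNt] at h
  refine ⟨h1K, ?_, ?_⟩
  · have h := h1K.smul (zero_le_two : (0 : ℝ) ≤ 2)
    convert h using 1
    module
  · rw [sub_add_cancel]
    exact hK.smul zero_le_two
end
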